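/- There exists an absolute constant c ∈ (0,∞) such that for every integer n ≥ 2 and every real t, |Σ_{k : k ≥ μ_n + t·σ_n} p_k^(n) − ∫_t^∞ e^{−u²/2}/√(2π) du| ≤ c/√(log n); that is, the normalized vertex number (f_0(T_n) − μ_n)/σ_n satisfies a Berry–Esseen bound of order 1/√(log n) with respect to the standard Gaussian distribution. -/

import Mathlib

open Finset

/-- `p n k` is the probability `p_k^{(n)} = P(f_0(T_n) = k)` that the random convex chain
`T_n` has exactly `k` vertices (besides the two corners), given by Buchta's formula:
`p_k^{(n)} = 2^k · Σ_{i_1+⋯+i_k = n, i_j ≥ 1} Π_{j=1}^{k} i_j / (s_j (s_j + 1))`,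
where `s_j = i_1 + ⋯ + i_j`.  In particular `p 0 0 = 1` and `p n 0 = 0` for `n ≥ 1`,
and `p n k = 0` for `k > n`. -/
noncomputable def p (n k : ℕ) : ℝ :=
  2 ^ k *
    ∑ i ∈ (Fintype.piFinset fun _ : Fin k => Finset.Icc 1 n).filter
        (fun i => ∑ j, i j = n),
      ∏ j : Fin k,
        (i j : ℝ) /
          (((∑ l ∈ Finset.univ.filter (fun l => l ≤ j), i l : ℕ) : ℝ) *
            (((∑ l ∈ Finset.univ.filter (fun l => l ≤ j), i l : ℕ) : ℝ) + 1))

/-- The mean `μ_n = E f_0(T_n) = Σ_{k=1}^n k p_k^{(n)}`. -/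
noncomputable def μ (n : ℕ) : ℝ := ∑ k ∈ Finset.Icc 1 n, (k : ℝ) * p n k

/-- The variance `σ_n² = Var f_0(T_n) = Σ_{k=1}^n (k − μ_n)² p_k^{(n)}`. -/
noncomputable def σsq (n : ℕ) : ℝ := ∑ k ∈ Finset.Icc 1 n, ((k : ℝ) - μ n) ^ 2 * p n k

/-- The upper-tail probability `P((f_0(T_n) − μ_n)/σ_n ≥ t) = Σ_{k ≥ μ_n + t σ_n} p_k^{(n)}`. -/
noncomputable def tailProb (n : ℕ) (t : ℝ) : ℝ :=
  ∑ k ∈ (Finset.Icc 1 n).filter (fun k : ℕ => μ n + t * Real.sqrt (σsq n) ≤ (k : ℝ)), p n k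

theorem p_zero_right (n : ℕ) : p n 0 = if n = 0 then 1 else 0 := by
  rcases Nat.eq_zero_or_pos n with rfl | h
  · simp [p]
  · have : ¬ (0 = n) := by omega
    simp [p, this, h.ne']

theorem p_nonneg (n k : ℕ) : 0 ≤ p n k := by
  unfold p
  positivity

theorem p_succ_right (n k : ℕ) :
    (n : ℝ) * (n + 1) * p n (k + 1) = 2 * ∑ m ∈ range n, ((n : ℝ) - m) * p m k := by
  rcases Nat.eq_zero_or_pos n with rfl | hn
  · simp
  have hn' : (n : ℝ) * (n + 1) ≠ 0 := by positivity
  have key : ∑ i ∈ (Fintype.piFinset fun _ : Fin (k + 1) => Finset.Icc 1 n).filter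
        (fun i => ∑ j, i j = n),
      ∏ j : Fin (k + 1),
        (i j : ℝ) /
          (((∑ l ∈ Finset.univ.filter (fun l => l ≤ j), i l : ℕ) : ℝ) *
            (((∑ l ∈ Finset.univ.filter (fun l => l ≤ j), i l : ℕ) : ℝ) + 1)) =
      ∑ m ∈ range n, ∑ i ∈ (Fintype.piFinset fun _ : Fin k => Finset.Icc 1 m).filter
        (fun i => ∑ j, i j = m), ((n : ℝ) - m) / (n * (n + 1)) *
      ∏ j : Fin k,
        (i j : ℝ) /
          (((∑ l ∈ Finset.univ.filter (fun l => l ≤ j), i l : ℕ) : ℝ) *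
            (((∑ l ∈ Finset.univ.filter (fun l => l ≤ j), i l : ℕ) : ℝ) + 1)) := by
    rw [Finset.sum_sigma']
    refine Finset.sum_bij' (fun i _ => ⟨∑ j : Fin k, i j.castSucc, fun j => i j.castSucc⟩)
      (fun x _ => Fin.snoc x.2 (n - x.1)) ?_ ?_ ?_ ?_ ?_
    · intro i hi
      simp only [mem_filter, Fintype.mem_piFinset, Finset.mem_Icc, Fin.sum_univ_castSucc] at hi
      simp only [mem_sigma, mem_range, mem_filter, Fintype.mem_piFinset, Finset.mem_Icc, and_true]
      refine ⟨by have := hi.1 (Fin.last k); omega, fun a => ⟨(hi.1 _).1, ?_⟩⟩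
      exact Finset.single_le_sum (f := fun j : Fin k => i j.castSucc) (fun _ _ => Nat.zero_le _)
        (mem_univ a)
    · rintro ⟨m, i⟩ hi
      simp only [mem_sigma, mem_range, mem_filter, Fintype.mem_piFinset, Finset.mem_Icc] at hi
      simp only [mem_filter, Fintype.mem_piFinset, Finset.mem_Icc, Fin.sum_univ_castSucc,
        Fin.snoc_castSucc, Fin.snoc_last]
      refine ⟨fun a => ?_, by omega⟩
      refine Fin.lastCases ?_ (fun j => ?_) a
      · simp only [Fin.snoc_last]; omega
      · simp only [Fin.snoc_castSucc]
        have := hi.2.1 j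
        omega
    · intro i hi
      simp only [mem_filter, Fintype.mem_piFinset, Finset.mem_Icc, Fin.sum_univ_castSucc] at hi
      funext a
      refine Fin.lastCases ?_ (fun j => ?_) a
      · simp only [Fin.snoc_last]; omega
      · simp only [Fin.snoc_castSucc]
    · rintro ⟨m, i⟩ hi
      simp only [mem_sigma, mem_range, mem_filter, Fintype.mem_piFinset, Finset.mem_Icc] at hi
      simp [hi.2.2]
    · intro i hi
      simp only [mem_filter, Fintype.mem_piFinset, Finset.mem_Icc, Fin.sum_univ_castSucc] at hi
      rw [Fin.prod_univ_castSucc, mul_comm]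
      have hlast : ∑ l ∈ Finset.univ.filter (fun l => l ≤ Fin.last k), i l = n := by
        simp [Fin.le_last, Fin.sum_univ_castSucc, hi.2]
      have hcast (j : Fin k) : ∑ l ∈ Finset.univ.filter (fun l => l ≤ j.castSucc), i l =
          ∑ l ∈ Finset.univ.filter (fun l => l ≤ j), i l.castSucc := by
        rw [sum_filter, sum_filter, Fin.sum_univ_castSucc]
        have : ¬ Fin.last k ≤ j.castSucc := by simp
        simp [this]
      congr 1
      · rw [hlast]
        congr 1
        rw [eq_sub_iff_add_eq]
        norm_cast
        dsimp only
        omega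
      · exact prod_congr rfl fun j _ => by rw [hcast]
  rw [p, key, mul_sum, mul_sum, mul_sum]
  refine sum_congr rfl fun m _ => ?_
  rw [p, ← mul_sum, pow_succ]
  field_simp

theorem p_eq_zero_of_lt {n k : ℕ} (h : n < k) : p n k = 0 := by
  induction k generalizing n with
  | zero => omega
  | succ k ih =>
    rcases Nat.eq_zero_or_pos n with rfl | hn
    · simp [p]
    · have := p_succ_right n k
      rw [sum_eq_zero fun m hm => by rw [ih (by simp at hm; omega), mul_zero]] at this
      have hn' : (n : ℝ) * (n + 1) ≠ 0 := by positivity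
      simpa [hn'] using this

open Polynomial in
/-- The generating polynomial `∑ k, p n k X ^ k` of the vertex number. -/
noncomputable def genPoly (n : ℕ) : Polynomial ℝ :=
  ∑ k ∈ range (n + 1), monomial k (p n k)

theorem coeff_genPoly (n k : ℕ) : (genPoly n).coeff k = p n k := by
  simp only [genPoly, Polynomial.finsetSum_coeff, Polynomial.coeff_monomial, sum_ite_eq',
    mem_range]
  split_ifs with h
  · rfl
  · exact (p_eq_zero_of_lt (by omega)).symm

section Recurrence
open Polynomial

theorem genPoly_eq_sum (n : ℕ) :
    C ((n : ℝ) * (n + 1)) * genPoly n =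
      2 * X * ∑ m ∈ range n, C ((n : ℝ) - m) * genPoly m := by
  ext k
  rw [show (2 : ℝ[X]) = C 2 by rfl, mul_assoc, coeff_C_mul, coeff_C_mul, coeff_genPoly]
  cases k with
  | zero =>
    rw [coeff_X_mul_zero, p_zero_right]
    split_ifs with h <;> simp [h]
  | succ k =>
    simp only [coeff_X_mul, finsetSum_coeff, coeff_C_mul, coeff_genPoly, p_succ_right]

theorem genPoly_zero : genPoly 0 = 1 := by
  simp [genPoly, p_zero_right]

theorem genPoly_one : genPoly 1 = X := by
  have h := genPoly_eq_sum 1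
  simp only [range_one, sum_singleton, genPoly_zero] at h
  norm_num at h
  exact mul_left_cancel₀ (by simp) (h : C (2 : ℝ) * genPoly 1 = C 2 * X)

theorem genPoly_sub (n : ℕ) :
    C (((n : ℝ) + 1) * (n + 2)) * genPoly (n + 1) - C ((n : ℝ) * (n + 1)) * genPoly n =
      2 * X * ∑ m ∈ range (n + 1), genPoly m := by
  have h := genPoly_eq_sum (n + 1)
  rw [genPoly_eq_sum n]
  push_cast at h
  rw [add_assoc, one_add_one_eq_two] at h
  rw [h, ← mul_sub, sum_range_succ, add_sub_right_comm, ← sum_sub_distrib, sum_range_succ]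
  congr 2
  · refine sum_congr rfl fun m _ => ?_
    rw [← sub_mul, ← C_sub, show (n : ℝ) + 1 - m - (n - m) = 1 by ring, C_1, one_mul]
  · simp

/-- The three-term recurrence for the generating polynomials. -/
theorem genPoly_add_two (n : ℕ) :
    C (((n : ℝ) + 2) * (n + 3)) * genPoly (n + 2) =
      2 * (C (((n : ℝ) + 1) * (n + 2)) + X) * genPoly (n + 1) -
        C ((n : ℝ) * (n + 1)) * genPoly n := by
  have h1 := genPoly_sub n
  have h2 := genPoly_sub (n + 1)
  rw [sum_range_succ, mul_add (2 * X), ← h1] at h2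
  push_cast at h2
  rw [add_assoc (n : ℝ), add_assoc (n : ℝ), one_add_one_eq_two,
    show (1 : ℝ) + 2 = 3 by norm_num] at h2
  linear_combination h2

theorem eval_one_genPoly (n : ℕ) : (genPoly n).eval 1 = 1 := by
  induction n using Nat.twoStepInduction with
  | zero => simp [genPoly_zero]
  | one => simp [genPoly_one]
  | more n h0 h1 =>
    have h := congrArg (eval 1) (genPoly_add_two n)
    simp only [eval_mul, eval_sub, eval_add, eval_C, eval_X, h0, h1, eval_ofNat] at h
    have : ((n : ℝ) + 2) * (n + 3) ≠ 0 := by positivity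
    refine mul_left_cancel₀ this ?_
    rw [h]
    ring

theorem derivative_genPoly_sub (n : ℕ) :
    (derivative (genPoly (n + 2))).eval 1 - (derivative (genPoly (n + 1))).eval 1 =
      2 / (3 * ((n : ℝ) + 2)) := by
  induction n with
  | zero =>
    have h := congrArg (fun q => (derivative q).eval 1) (genPoly_add_two 0)
    simp only [derivative_mul, derivative_sub, derivative_add, derivative_C, derivative_X,
      eval_mul, eval_sub, eval_add, eval_C, eval_X, genPoly_zero,
      eval_ofNat, derivative_ofNat, eval_zero, eval_one] at h ⊢
    norm_num [genPoly_one] at h ⊢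
    linarith
  | succ n ih =>
    have h := congrArg (fun q => (derivative q).eval 1) (genPoly_add_two (n + 1))
    simp only [derivative_mul, derivative_sub, derivative_add, derivative_C, derivative_X,
      eval_mul, eval_sub, eval_add, eval_C, eval_X, eval_one_genPoly,
      eval_ofNat, derivative_ofNat, eval_zero, eval_one] at h ⊢
    push_cast at h ⊢
    have e := sub_eq_iff_eq_add.1 ih
    set a := (derivative (genPoly (n + 1))).eval 1
    rw [add_assoc n 1 1, one_add_one_eq_two, e] at h
    rw [add_assoc n 1 1, one_add_one_eq_two, e]
    have : (n : ℝ) + 2 ≠ 0 := by positivity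
    have : (n : ℝ) + 3 ≠ 0 := by positivity
    have : (n : ℝ) + 4 ≠ 0 := by positivity
    rw [show (n : ℝ) + 1 + 2 = n + 3 by ring, show (n : ℝ) + 1 + 3 = n + 4 by ring,
      show n + 1 + 2 = n + 3 by ring] at *
    simp only [zero_mul, zero_add, mul_one] at h
    rw [mul_comm, ← eq_div_iff (by positivity)] at h
    rw [h]
    field_simp
    ring

theorem derivative_two_genPoly_sub (n : ℕ) :
    (derivative (derivative (genPoly (n + 2)))).eval 1 -
        (derivative (derivative (genPoly (n + 1)))).eval 1 =
      4 / (3 * ((n : ℝ) + 2)) * (derivative (genPoly (n + 1))).eval 1 -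
        4 * n * (2 * n + 7) / (27 * ((n : ℝ) + 2) ^ 2 * (n + 3)) := by
  induction n with
  | zero =>
    have h := congrArg (fun q => (derivative (derivative q)).eval 1) (genPoly_add_two 0)
    simp only [derivative_mul, derivative_sub, derivative_add, derivative_C, derivative_X,
      eval_mul, eval_sub, eval_add, eval_C, eval_X, genPoly_zero,
      eval_ofNat, derivative_ofNat, derivative_one, derivative_zero, eval_zero,
      eval_one] at h ⊢
    norm_num [genPoly_one] at h ⊢
    linarith
  | succ n ih =>
    have h := congrArg (fun q => (derivative (derivative q)).eval 1) (genPoly_add_two (n + 1))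
    simp only [derivative_mul, derivative_sub, derivative_add, derivative_C, derivative_X,
      eval_mul, eval_sub, eval_add, eval_C, eval_X, eval_one_genPoly,
      eval_ofNat, derivative_ofNat, derivative_one, derivative_zero, eval_zero,
      eval_one] at h ⊢
    push_cast at h ⊢
    have e := sub_eq_iff_eq_add.1 ih
    have e' := sub_eq_iff_eq_add.1 (derivative_genPoly_sub n)
    set a := (derivative (genPoly (n + 1))).eval 1
    set b := (derivative (derivative (genPoly (n + 1)))).eval 1
    rw [add_assoc n 1 1, one_add_one_eq_two, e, e'] at h
    rw [add_assoc n 1 1, one_add_one_eq_two, e, e']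
    have : (n : ℝ) + 2 ≠ 0 := by positivity
    have : (n : ℝ) + 3 ≠ 0 := by positivity
    have : (n : ℝ) + 4 ≠ 0 := by positivity
    rw [show (n : ℝ) + 1 + 2 = n + 3 by ring, show (n : ℝ) + 1 + 3 = n + 4 by ring,
      show n + 1 + 2 = n + 3 by ring] at *
    simp only [zero_mul, zero_add, mul_zero, add_zero, mul_one] at h
    rw [mul_comm, ← eq_div_iff (by positivity)] at h
    rw [h]
    field_simp
    ring

end Recurrence

section RealRooted
open Polynomial

theorem im_genPoly_mul_conj_pos {z : ℂ} (hz : 0 < z.im) (n : ℕ) :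
    0 < (aeval z (genPoly (n + 1)) * (starRingEnd ℂ) (aeval z (genPoly n))).im := by
  induction n with
  | zero => simpa [genPoly_one, genPoly_zero] using hz
  | succ n ih =>
    have h := congrArg (aeval z) (genPoly_add_two n)
    simp only [map_mul, map_sub, map_add, aeval_X, map_ofNat, map_natCast, map_one] at h
    rw [show n + 1 + 1 = n + 2 by rfl]
    set u := aeval z (genPoly (n + 2))
    set v := aeval z (genPoly (n + 1))
    set w := aeval z (genPoly n)
    have hv : 0 < Complex.normSq v := by
      rw [Complex.normSq_pos]
      intro h0
      simp [h0] at ih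
    have h2 : ((((n : ℝ) + 2) * (n + 3) : ℝ) : ℂ) * (u * (starRingEnd ℂ) v) =
        (2 * (((n : ℝ) + 1) * (n + 2)) * Complex.normSq v : ℝ) +
          ((2 * Complex.normSq v : ℝ) : ℂ) * z -
          (((n : ℝ) * (n + 1) : ℝ) : ℂ) * (w * (starRingEnd ℂ) v) := by
      have e := Complex.mul_conj v
      push_cast
      linear_combination (starRingEnd ℂ) v * h + 2 * (((n : ℂ) + 1) * (n + 2) + z) * e
    have h3 := congrArg Complex.im h2
    rw [Complex.sub_im, Complex.add_im, Complex.ofReal_im, Complex.im_ofReal_mul,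
      Complex.im_ofReal_mul, Complex.im_ofReal_mul] at h3
    have h4 : (w * (starRingEnd ℂ) v).im = -(v * (starRingEnd ℂ) w).im := by
      simp only [Complex.mul_im, Complex.conj_re, Complex.conj_im]
      ring
    rw [h4] at h3
    have h5 : 0 < ((n : ℝ) + 2) * (n + 3) * (u * (starRingEnd ℂ) v).im := by
      rw [h3]
      have : 0 ≤ (n : ℝ) * (n + 1) * (v * (starRingEnd ℂ) w).im := by positivity
      have : 0 < 2 * Complex.normSq v * z.im := by positivity
      linarith
    exact pos_of_mul_pos_right h5 (by positivity)

theorem aeval_genPoly_ne_zero {z : ℂ} (hz : z.im ≠ 0) (n : ℕ) : aeval z (genPoly n) ≠ 0 := by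
  intro h
  rcases lt_or_gt_of_ne hz with hz | hz
  · have h1 := im_genPoly_mul_conj_pos (z := (starRingEnd ℂ) z) (by simpa using hz) n
    rw [aeval_conj, aeval_conj, h] at h1
    simp at h1
  · have h1 := im_genPoly_mul_conj_pos hz n
    simp [h] at h1

theorem splits_of_forall_aeval_ne_zero {f : ℝ[X]}
    (hf : ∀ z : ℂ, z.im ≠ 0 → aeval z f ≠ 0) : f.Splits := by
  have h0 : f ≠ 0 := by
    rintro rfl
    exact hf Complex.I (by simp) (by simp)
  refine (IsAlgClosed.splits (f.map (algebraMap ℝ ℂ))).of_splits_map_of_injective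
    (algebraMap ℝ ℂ).injective fun z hz => ?_
  rw [mem_roots_map h0, eval₂_eq_eval_map, eval_map_algebraMap] at hz
  have him : z.im = 0 := by
    by_contra h
    exact hf z h hz
  exact ⟨z.re, by apply Complex.ext <;> simp [him]⟩

theorem splits_genPoly (n : ℕ) : (genPoly n).Splits :=
  splits_of_forall_aeval_ne_zero fun _ hz => aeval_genPoly_ne_zero hz n

/-- A real-rooted polynomial with value `1` at `1` and no positive root is the generating
polynomial of a sum of independent Bernoulli variables. -/
theorem exists_eq_prod_bernoulli {f : ℝ[X]} (hf : f.Splits) (h1 : f.eval 1 = 1)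
    (hpos : ∀ x, 0 < x → f.eval x ≠ 0) :
    ∃ (m : ℕ) (q : Fin m → ℝ), (∀ i, 0 ≤ q i ∧ q i ≤ 1) ∧
      f = ∏ i, (C (1 - q i) + C (q i) * X) := by
  have h0 : f ≠ 0 := by
    rintro rfl
    simp at h1
  have hroot : ∀ a ∈ f.roots, a ≤ 0 := by
    intro a ha
    by_contra! h
    exact hpos a h (isRoot_of_mem_roots ha)
  have hfac := hf.eq_prod_roots
  set l := f.roots.toList with hl
  have hlroots : f.roots = (l : Multiset ℝ) := by simp [hl]
  rw [hlroots] at hfac hroot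
  have hl0 : ∀ i : Fin l.length, l[i] ≤ 0 := fun i => hroot _ (by simp)
  have hprod : f = C f.leadingCoeff * ∏ i : Fin l.length, (X - C l[i]) := by
    conv_lhs => rw [hfac]
    rw [Multiset.map_coe, Multiset.prod_coe, ← Fin.prod_univ_fun_getElem]
    rfl
  refine ⟨l.length, fun i => 1 / (1 - l[i]), fun i => ?_, ?_⟩
  · have := hl0 i
    exact ⟨by apply div_nonneg <;> linarith, by rw [div_le_one] <;> linarith⟩
  · have hne : ∀ i : Fin l.length, 1 - l[i] ≠ 0 := fun i => by have := hl0 i; linarith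
    have hc : f.leadingCoeff * ∏ i : Fin l.length, (1 - l[i]) = 1 := by
      have := congrArg (eval 1) hprod
      simpa [h1, eval_prod] using this.symm
    conv_lhs => rw [hprod]
    have : ∀ i : Fin l.length, X - C l[i] =
        C (1 - l[i]) * (C (1 - 1 / (1 - l[i])) + C (1 / (1 - l[i])) * X) := by
      intro i
      rw [mul_add, ← mul_assoc, ← C_mul, ← C_mul, mul_one_div_cancel (hne i), mul_sub,
        mul_one_div_cancel (hne i)]
      simp
      ring
    rw [prod_congr rfl fun i _ => this i, prod_mul_distrib, ← mul_assoc, ← map_prod C, ← C_mul, hc,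
      C_1, one_mul]

theorem eval_genPoly_pos (n : ℕ) {x : ℝ} (hx : 0 < x) : 0 < (genPoly n).eval x := by
  have h := eval_one_genPoly n
  simp only [genPoly, eval_finsetSum, eval_monomial, one_pow, mul_one] at h ⊢
  refine lt_of_le_of_ne (sum_nonneg fun k _ => mul_nonneg (p_nonneg n k) (by positivity)) ?_
  intro h0
  rw [eq_comm, sum_eq_zero_iff_of_nonneg
    fun k _ => mul_nonneg (p_nonneg n k) (by positivity)] at h0
  rw [sum_eq_zero fun k hk => by simpa [hx.ne'] using h0 k hk] at h
  exact zero_ne_one h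

end RealRooted

section PolySum
open Polynomial

/-- The linear functional sending `X ^ k` to `φ k`: for a probability generating function `G`,
this is the expectation of `φ`. -/
noncomputable def polySum (φ : ℕ → ℝ) : ℝ[X] →ₗ[ℝ] ℝ :=
  lsum fun k => φ k • LinearMap.id

theorem polySum_apply (φ : ℕ → ℝ) (G : ℝ[X]) : polySum φ G = G.sum fun k a => φ k * a := rfl

theorem polySum_monomial (φ : ℕ → ℝ) (k : ℕ) (a : ℝ) : polySum φ (monomial k a) = φ k * a := by
  rw [polySum_apply, sum_monomial_index _ _ (by simp)]

theorem polySum_C_mul (φ : ℕ → ℝ) (a : ℝ) (G : ℝ[X]) : polySum φ (C a * G) = a * polySum φ G := by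
  rw [← smul_eq_C_mul, map_smul, smul_eq_mul]

theorem polySum_add_left (φ ψ : ℕ → ℝ) (G : ℝ[X]) :
    polySum (fun k => φ k + ψ k) G = polySum φ G + polySum ψ G := by
  simp only [polySum_apply, Polynomial.sum, add_mul, sum_add_distrib]

theorem polySum_mul_left (a : ℝ) (φ : ℕ → ℝ) (G : ℝ[X]) :
    polySum (fun k => a * φ k) G = a * polySum φ G := by
  simp only [polySum_apply, Polynomial.sum, mul_assoc, mul_sum]

theorem polySum_neg_left (φ : ℕ → ℝ) (G : ℝ[X]) :
    polySum (fun k => -φ k) G = -polySum φ G := by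
  simp only [polySum_apply, Polynomial.sum, neg_mul, sum_neg_distrib]

theorem polySum_sub_left (φ ψ : ℕ → ℝ) (G : ℝ[X]) :
    polySum (fun k => φ k - ψ k) G = polySum φ G - polySum ψ G := by
  simp only [polySum_apply, Polynomial.sum, sub_mul, sum_sub_distrib]

theorem polySum_one (G : ℝ[X]) : polySum (fun _ => 1) G = G.eval 1 := by
  simp [polySum_apply, eval_eq_sum]

theorem polySum_X_mul (φ : ℕ → ℝ) (G : ℝ[X]) :
    polySum φ (X * G) = polySum (fun k => φ (k + 1)) G := by
  induction G using Polynomial.induction_on' with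
  | add p q hp hq => rw [mul_add, map_add, map_add, hp, hq]
  | monomial n a => rw [X_mul_monomial, polySum_monomial, polySum_monomial]

theorem polySum_natCast_mul (φ : ℕ → ℝ) (G : ℝ[X]) :
    polySum (fun k => k * φ k) G = polySum φ (X * derivative G) := by
  induction G using Polynomial.induction_on' with
  | add p q hp hq => rw [map_add, hp, hq, derivative_add, mul_add, map_add]
  | monomial n a =>
    rw [polySum_monomial, derivative_monomial, X_mul_monomial, polySum_monomial]
    cases n with
    | zero => simp
    | succ n => simp; ring

theorem polySum_mono {φ ψ : ℕ → ℝ} (h : ∀ k, φ k ≤ ψ k) {G : ℝ[X]} (hG : ∀ k, 0 ≤ G.coeff k) :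
    polySum φ G ≤ polySum ψ G :=
  sum_le_sum fun k _ => mul_le_mul_of_nonneg_right (h k) (hG k)

theorem coeff_prod_nonneg {ι : Type*} (s : Finset ι) (f : ι → ℝ[X])
    (hf : ∀ i ∈ s, ∀ k, 0 ≤ (f i).coeff k) (k : ℕ) : 0 ≤ (∏ i ∈ s, f i).coeff k := by
  classical
  induction s using Finset.induction_on generalizing k with
  | empty => rw [prod_empty, coeff_one]; split_ifs <;> simp
  | insert i s his ih =>
    rw [prod_insert his, coeff_mul]
    exact sum_nonneg fun x _ => mul_nonneg (hf i (mem_insert_self _ _) _)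
      (ih (fun j hj => hf j (mem_insert_of_mem hj)) _)

theorem coeff_bernoulli_nonneg {q : ℝ} (h0 : 0 ≤ q) (h1 : q ≤ 1) (k : ℕ) :
    0 ≤ (C (1 - q) + C q * X).coeff k := by
  rw [coeff_add, coeff_C_mul, coeff_C, coeff_X]
  split_ifs <;> simp <;> linarith

/-- Stein identity for sums of independent Bernoulli variables, as an inequality: the leave-one-out
differences of `φ` are compared with a function `ψ` of the full sum. -/
theorem polySum_sub_mul_le {m : ℕ} {q : Fin m → ℝ} (hq : ∀ i, 0 ≤ q i ∧ q i ≤ 1)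
    {φ ψ : ℕ → ℝ} (h0 : ∀ k, φ (k + 1) - φ k ≤ ψ k) (h1 : ∀ k, φ (k + 1) - φ k ≤ ψ (k + 1)) :
    polySum (fun k => (k - ∑ i, q i) * φ k) (∏ i, (C (1 - q i) + C (q i) * X)) ≤
      (∑ i, q i * (1 - q i)) * polySum ψ (∏ i, (C (1 - q i) + C (q i) * X)) := by
  set B : Fin m → ℝ[X] := fun i => C (1 - q i) + C (q i) * X with hB
  set G : Fin m → ℝ[X] := fun i => ∏ j ∈ univ.erase i, B j with hG
  have hBG (i : Fin m) : ∏ i, B i = B i * G i := (mul_prod_erase _ _ (mem_univ i)).symm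
  have hder : X * derivative (∏ i, B i) - C (∑ i, q i) * ∏ i, B i =
      ∑ i, C (q i * (1 - q i)) * (X * G i - G i) := by
    rw [derivative_prod_finset, map_sum, sum_mul, mul_sum, ← sum_sub_distrib]
    refine sum_congr rfl fun i _ => ?_
    rw [hBG i]
    change X * (G i * derivative (B i)) - C (q i) * (B i * G i) = _
    have hd : derivative (B i) = C (q i) := by simp [hB]
    rw [hd]
    simp only [hB, C_mul, C_sub, C_1]
    ring
  have hL : polySum (fun k => (k - ∑ i, q i) * φ k) (∏ i, B i) =
      ∑ i, q i * (1 - q i) * polySum (fun k => φ (k + 1) - φ k) (G i) := by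
    have e : polySum (fun k => (k - ∑ i, q i) * φ k) (∏ i, B i) =
        polySum φ (X * derivative (∏ i, B i) - C (∑ i, q i) * ∏ i, B i) := by
      rw [map_sub, polySum_C_mul, ← polySum_natCast_mul, ← polySum_mul_left, ← polySum_sub_left]
      congr 2
      funext k
      ring
    rw [e, hder, map_sum]
    refine sum_congr rfl fun i _ => ?_
    rw [polySum_C_mul, map_sub, polySum_X_mul, ← polySum_sub_left]
  rw [hL, sum_mul]
  refine sum_le_sum fun i _ => ?_
  obtain ⟨hq0, hq1⟩ := hq i
  refine mul_le_mul_of_nonneg_left ?_ (mul_nonneg hq0 (by linarith))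
  have hR : polySum ψ (∏ i, B i) =
      polySum (fun k => (1 - q i) * ψ k + q i * ψ (k + 1)) (G i) := by
    rw [hBG i, polySum_add_left, polySum_mul_left, polySum_mul_left, ← polySum_X_mul, ← polySum_C_mul,
      ← polySum_C_mul, ← map_add, hB]
    congr 1
    ring
  rw [hR]
  refine polySum_mono (fun k => ?_)
    (coeff_prod_nonneg _ _ fun j _ => coeff_bernoulli_nonneg (hq j).1 (hq j).2)
  nlinarith [mul_le_mul_of_nonneg_left (h0 k) (sub_nonneg.2 hq1),
    mul_le_mul_of_nonneg_left (h1 k) hq0]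

end PolySum

section Gaussian
open MeasureTheory Filter Topology

/-- The standard Gaussian density. -/
noncomputable def gaussDens (u : ℝ) : ℝ := Real.exp (-u ^ 2 / 2) / Real.sqrt (2 * Real.pi)

/-- The upper tail of the standard Gaussian distribution. -/
noncomputable def gaussTail (t : ℝ) : ℝ := ∫ u in Set.Ioi t, gaussDens u

theorem gaussDens_pos (u : ℝ) : 0 < gaussDens u := by
  unfold gaussDens
  positivity

theorem gaussDens_neg (u : ℝ) : gaussDens (-u) = gaussDens u := by
  simp [gaussDens]

theorem one_le_sqrt_two_pi : 1 ≤ Real.sqrt (2 * Real.pi) :=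
  Real.one_le_sqrt.2 (by linarith [Real.pi_gt_three])

theorem gaussDens_le_one (u : ℝ) : gaussDens u ≤ 1 := by
  unfold gaussDens
  rw [div_le_one (by positivity)]
  refine le_trans (Real.exp_le_one_iff.2 ?_) one_le_sqrt_two_pi
  have := sq_nonneg u
  linarith

theorem hasDerivAt_gaussDens (u : ℝ) : HasDerivAt gaussDens (-(u * gaussDens u)) u := by
  have h : HasDerivAt (fun u : ℝ => -u ^ 2 / 2) (-u) u := by
    exact (((hasDerivAt_pow 2 u).fun_neg).div_const 2).congr_deriv (by simp; ring)
  refine (h.exp.div_const (Real.sqrt (2 * Real.pi))).congr_deriv ?_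
  unfold gaussDens
  ring

theorem continuous_gaussDens : Continuous gaussDens :=
  continuous_iff_continuousAt.2 fun u => (hasDerivAt_gaussDens u).continuousAt

theorem integrable_gaussDens : Integrable gaussDens := by
  have := (integrable_exp_neg_mul_sq (b := 1 / 2) (by norm_num)).div_const (Real.sqrt (2 * Real.pi))
  refine this.congr (Eventually.of_forall fun u => ?_)
  simp only [gaussDens]
  congr 2
  ring

theorem integral_gaussDens : ∫ u, gaussDens u = 1 := by
  have h : ∀ u, gaussDens u = Real.exp (-(1 / 2) * u ^ 2) / Real.sqrt (2 * Real.pi) := by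
    intro u
    simp only [gaussDens]
    congr 2
    ring
  simp_rw [h]
  rw [integral_div, integral_gaussian, show Real.pi / (1 / 2) = 2 * Real.pi by ring]
  exact div_self (by positivity)

theorem gaussTail_sub (a b : ℝ) : gaussTail a - gaussTail b = ∫ u in a..b, gaussDens u :=
  intervalIntegral.integral_Ioi_sub_Ioi' integrable_gaussDens.integrableOn
    integrable_gaussDens.integrableOn

theorem hasDerivAt_gaussTail (t : ℝ) : HasDerivAt gaussTail (-gaussDens t) t := by
  have h := (intervalIntegral.integral_hasDerivAt_right (a := 0) (b := t) (f := gaussDens)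
    (continuous_gaussDens.intervalIntegrable _ _)
    (continuous_gaussDens.stronglyMeasurableAtFilter _ _) continuous_gaussDens.continuousAt)
  refine (h.const_sub (gaussTail 0)).congr_of_eventuallyEq (Eventually.of_forall fun b => ?_)
  simp only [← gaussTail_sub, sub_sub_cancel]

theorem gaussTail_nonneg (t : ℝ) : 0 ≤ gaussTail t :=
  setIntegral_nonneg measurableSet_Ioi fun u _ => (gaussDens_pos u).le

theorem gaussTail_add_neg (t : ℝ) : gaussTail t + gaussTail (-t) = 1 := by
  have h : gaussTail (-t) = ∫ u in Set.Iic t, gaussDens u := by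
    have := integral_comp_neg_Iic t gaussDens
    simp only [gaussDens_neg] at this
    rw [gaussTail, this]
  rw [h, add_comm, gaussTail, intervalIntegral.integral_Iic_add_Ioi
    integrable_gaussDens.integrableOn integrable_gaussDens.integrableOn, integral_gaussDens]

theorem gaussTail_le_one (t : ℝ) : gaussTail t ≤ 1 := by
  linarith [gaussTail_add_neg t, gaussTail_nonneg (-t)]

theorem gaussTail_antitone : Antitone gaussTail :=
  antitone_of_hasDerivAt_nonpos hasDerivAt_gaussTail fun x => by
    simpa using (gaussDens_pos x).le

theorem gaussTail_sub_le {a b : ℝ} (hab : a ≤ b) : gaussTail a - gaussTail b ≤ b - a := by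
  rw [gaussTail_sub]
  calc ∫ u in a..b, gaussDens u ≤ ∫ _ in a..b, (1 : ℝ) :=
        intervalIntegral.integral_mono_on hab (continuous_gaussDens.intervalIntegrable _ _)
          (by simp) fun u _ => gaussDens_le_one u
    _ = b - a := by simp

theorem tendsto_gaussDens_atTop : Tendsto gaussDens atTop (𝓝 0) := by
  have h : Tendsto (fun u : ℝ => -u ^ 2 / 2) atTop atBot := by
    have := (tendsto_neg_atTop_atBot.comp (tendsto_pow_atTop (α := ℝ) two_ne_zero)).atBot_div_const
      (r := 2) (by norm_num)
    exact this
  have h2 := (Real.tendsto_exp_atBot.comp h).div_const (Real.sqrt (2 * Real.pi))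
  rwa [zero_div] at h2

theorem mul_gaussTail_le {t : ℝ} (ht : 0 ≤ t) : t * gaussTail t ≤ gaussDens t := by
  have hd : ∀ x ∈ Set.Ici t, HasDerivAt (fun x => -gaussDens x) (x * gaussDens x) x := fun x _ =>
    (hasDerivAt_gaussDens x).fun_neg.congr_deriv (neg_neg _)
  have hlim : Tendsto (fun x => -gaussDens x) atTop (𝓝 0) := by
    simpa using tendsto_gaussDens_atTop.neg
  have hpos : ∀ x ∈ Set.Ioi t, 0 ≤ x * gaussDens x := fun x hx =>
    mul_nonneg (ht.trans (le_of_lt hx)) (gaussDens_pos x).le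
  have hintegrable := integrableOn_Ioi_deriv_of_nonneg' hd hpos hlim
  have hval := integral_Ioi_of_hasDerivAt_of_tendsto' hd hintegrable hlim
  rw [zero_sub, neg_neg] at hval
  rw [← hval, gaussTail, ← integral_const_mul]
  refine setIntegral_mono_on (integrable_gaussDens.integrableOn.const_mul _) hintegrable
    measurableSet_Ioi fun x hx => mul_le_mul_of_nonneg_right (le_of_lt hx) (gaussDens_pos x).le

theorem gaussTail_le {t : ℝ} (ht : 0 ≤ t) : gaussTail t ≤ 6 * gaussDens t := by
  have hg := gaussDens_pos t
  rcases le_total 1 t with h1 | h1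
  · have := mul_gaussTail_le ht
    nlinarith [gaussTail_nonneg t]
  · refine (gaussTail_le_one t).trans ?_
    have he : 1 / 2 ≤ Real.exp (-t ^ 2 / 2) := by
      have := Real.add_one_le_exp (-t ^ 2 / 2)
      nlinarith
    have hs : Real.sqrt (2 * Real.pi) ≤ 3 := by
      rw [Real.sqrt_le_left (by norm_num)]
      linarith [Real.pi_lt_four]
    unfold gaussDens
    rw [mul_div_assoc', le_div_iff₀ (by positivity)]
    linarith

/-- The bounded solution of the Stein equation for the half-line `[t, ∞)`. -/
noncomputable def steinSol (t w : ℝ) : ℝ :=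
  -(gaussTail (max t w) * gaussTail (-(min t w))) / gaussDens w

theorem abs_steinSol_le_div (t w : ℝ) : |steinSol t w| ≤ gaussTail |w| / gaussDens w := by
  have h0 := gaussTail_nonneg
  have h1 := gaussTail_le_one
  rw [steinSol, abs_div, abs_neg, abs_of_pos (gaussDens_pos w), abs_of_nonneg
    (mul_nonneg (h0 _) (h0 _))]
  refine div_le_div_of_nonneg_right ?_ (gaussDens_pos w).le
  rcases le_total 0 w with hw | hw
  · rw [abs_of_nonneg hw]
    exact (mul_le_of_le_one_right (h0 _) (h1 _)).trans (gaussTail_antitone (le_max_right t w))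
  · rw [abs_of_nonpos hw]
    exact (mul_le_of_le_one_left (h0 _) (h1 _)).trans
      (gaussTail_antitone (neg_le_neg (min_le_right t w)))

theorem gaussDens_abs (w : ℝ) : gaussDens |w| = gaussDens w := by
  simp [gaussDens]

theorem abs_steinSol_le (t w : ℝ) : |steinSol t w| ≤ 6 :=
  (abs_steinSol_le_div t w).trans <| by
    rw [div_le_iff₀ (gaussDens_pos w), ← gaussDens_abs]
    exact gaussTail_le (abs_nonneg w)

theorem abs_mul_steinSol_le (t w : ℝ) : |w * steinSol t w| ≤ 1 := by
  rw [abs_mul]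
  refine (mul_le_mul_of_nonneg_left (abs_steinSol_le_div t w) (abs_nonneg w)).trans ?_
  rw [mul_div_assoc', div_le_one (gaussDens_pos w), ← gaussDens_abs]
  exact mul_gaussTail_le (abs_nonneg w)

theorem continuous_gaussTail : Continuous gaussTail :=
  continuous_iff_continuousAt.2 fun u => (hasDerivAt_gaussTail u).continuousAt

theorem continuous_steinSol (t : ℝ) : Continuous (steinSol t) := by
  have h1 := continuous_gaussTail
  have h2 := continuous_gaussDens
  unfold steinSol
  exact Continuous.div (by fun_prop) h2 fun w => (gaussDens_pos w).ne'

/-- The Stein equation, with a one-sided derivative. -/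
theorem hasDerivWithinAt_steinSol (t w : ℝ) :
    HasDerivWithinAt (steinSol t)
      (w * steinSol t w + (if t ≤ w then 1 else 0) - gaussTail t) (Set.Ici w) w := by
  have hg := (gaussDens_pos w).ne'
  split_ifs with h
  · have hd : HasDerivAt (fun x => -(gaussTail x * gaussTail (-t)) / gaussDens x)
        (w * (-(gaussTail w * gaussTail (-t)) / gaussDens w) + 1 - gaussTail t) w := by
      refine ((((hasDerivAt_gaussTail w).mul_const (gaussTail (-t))).fun_neg).fun_div
        (hasDerivAt_gaussDens w) hg).congr_deriv ?_
      have e := gaussTail_add_neg t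
      rw [show gaussTail t = 1 - gaussTail (-t) by linarith]
      field_simp
      ring
    have he : ∀ x ∈ Set.Ici w, steinSol t x = -(gaussTail x * gaussTail (-t)) / gaussDens x := by
      intro x hx
      have : t ≤ x := h.trans hx
      rw [steinSol, max_eq_right this, min_eq_left this]
    rw [he w Set.self_mem_Ici]
    exact hd.hasDerivWithinAt.congr he (he w Set.self_mem_Ici)
  · push Not at h
    have hd : HasDerivAt (fun x => -(gaussTail t * gaussTail (-x)) / gaussDens x)
        (w * (-(gaussTail t * gaussTail (-w)) / gaussDens w) + 0 - gaussTail t) w := by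
      have h1 : HasDerivAt (fun x => gaussTail (-x)) (gaussDens w) w := by
        have := (hasDerivAt_gaussTail (-w)).comp w (hasDerivAt_neg w)
        rw [gaussDens_neg] at this
        exact this.congr_deriv (by simp)
      refine (((h1.const_mul (gaussTail t)).fun_neg).fun_div
        (hasDerivAt_gaussDens w) hg).congr_deriv ?_
      field_simp
      ring
    have he : ∀ x, x ≤ t → steinSol t x = -(gaussTail t * gaussTail (-x)) / gaussDens x := by
      intro x hx
      rw [steinSol, max_eq_left hx, min_eq_right hx]
    rw [he w h.le]
    refine (hd.congr_of_eventuallyEq ?_).hasDerivWithinAt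
    filter_upwards [Iio_mem_nhds h] with x hx using he x (le_of_lt hx)

theorem steinSol_sub_le {t a b m : ℝ} (hab : a ≤ b)
    (hm : ∀ x ∈ Set.Icc a b, x * steinSol t x ≤ m) :
    steinSol t b - steinSol t a ≤ (b - a) * (m + (if t ≤ b then 1 else 0) - gaussTail t) := by
  set c := m + (if t ≤ b then 1 else 0) - gaussTail t
  have key := image_le_of_deriv_right_le_deriv_boundary
    (continuous_steinSol t).continuousOn (fun x _ => hasDerivWithinAt_steinSol t x)
    (B := fun x => steinSol t a + (x - a) * c) (B' := fun _ => c) (a := a) (b := b) (by simp)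
    (by fun_prop) (fun x _ => by
      simpa using ((((hasDerivAt_id x).sub_const a).mul_const c).const_add
        (steinSol t a)).hasDerivWithinAt)
    (fun x hx => by
      have h1 := hm x ⟨hx.1, hx.2.le⟩
      have h2 : (if t ≤ x then (1 : ℝ) else 0) ≤ if t ≤ b then 1 else 0 := by
        split_ifs with h h' <;> first | exact absurd (h.trans hx.2.le) h' | norm_num
      linarith)
    (Set.right_mem_Icc.2 hab)
  linarith

theorem le_steinSol_sub {t a b m : ℝ} (hab : a ≤ b)
    (hm : ∀ x ∈ Set.Icc a b, m ≤ x * steinSol t x) :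
    (b - a) * (m + (if t ≤ a then 1 else 0) - gaussTail t) ≤ steinSol t b - steinSol t a := by
  set c := m + (if t ≤ a then 1 else 0) - gaussTail t
  have key := image_le_of_deriv_right_le_deriv_boundary
    (f := fun x => steinSol t a + (x - a) * c) (f' := fun _ => c) (a := a) (b := b)
    (by fun_prop) (fun x _ => by
      simpa using ((((hasDerivAt_id x).sub_const a).mul_const c).const_add
        (steinSol t a)).hasDerivWithinAt)
    (B := steinSol t) (by simp) (continuous_steinSol t).continuousOn
    (fun x _ => hasDerivWithinAt_steinSol t x)
    (fun x hx => by
      have h1 := hm x ⟨hx.1, hx.2.le⟩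
      have h2 : (if t ≤ a then (1 : ℝ) else 0) ≤ if t ≤ x then 1 else 0 := by
        split_ifs with h h' <;> first | exact absurd (h.trans hx.1) h' | norm_num
      linarith)
    (Set.right_mem_Icc.2 hab)
  linarith

theorem abs_steinSol_sub_le (t x y : ℝ) : |steinSol t x - steinSol t y| ≤ 2 * |x - y| := by
  wlog h : y ≤ x generalizing x y
  · rw [abs_sub_comm, abs_sub_comm x]
    exact this y x (le_of_not_ge h)
  rw [abs_of_nonneg (sub_nonneg.2 h), abs_le]
  have h1 := steinSol_sub_le (t := t) (m := 1) h fun z _ => (abs_le.1 (abs_mul_steinSol_le t z)).2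
  have h2 := le_steinSol_sub (t := t) (m := -1) h
    fun z _ => (abs_le.1 (abs_mul_steinSol_le t z)).1
  have h3 := gaussTail_nonneg t
  have h4 := gaussTail_le_one t
  have h5 : 0 ≤ x - y := sub_nonneg.2 h
  constructor
  · refine le_trans ?_ h2
    split_ifs <;> nlinarith
  · refine h1.trans ?_
    split_ifs <;> nlinarith

/-- The map `x ↦ x * steinSol t x` is locally Lipschitz, with linearly growing constant. -/
theorem abs_mul_steinSol_sub_le (t x y : ℝ) :
    |x * steinSol t x - y * steinSol t y| ≤ (6 + 2 * |y|) * |x - y| := by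
  have e : x * steinSol t x - y * steinSol t y =
      (x - y) * steinSol t x + y * (steinSol t x - steinSol t y) := by ring
  rw [e]
  refine (abs_add_le _ _).trans ?_
  rw [abs_mul, abs_mul]
  have h1 := mul_le_mul_of_nonneg_left (abs_steinSol_le t x) (abs_nonneg (x - y))
  have h2 := mul_le_mul_of_nonneg_left (abs_steinSol_sub_le t x y) (abs_nonneg y)
  linarith

end Gaussian

section BernoulliSum
open Polynomial

variable {m : ℕ} {q : Fin m → ℝ}

theorem polySum_const_bernoulli (q : Fin m → ℝ) (a : ℝ) :
    polySum (fun _ => a) (∏ i, (C (1 - q i) + C (q i) * X)) = a := by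
  have h := polySum_mul_left a (fun _ => 1) (∏ i, (C (1 - q i) + C (q i) * X))
  rw [polySum_one, eval_prod] at h
  simpa using h

theorem polySum_sub_mean (hq : ∀ i, 0 ≤ q i ∧ q i ≤ 1) :
    polySum (fun k => (k : ℝ) - ∑ i, q i) (∏ i, (C (1 - q i) + C (q i) * X)) = 0 := by
  have h1 := polySum_sub_mul_le hq (φ := fun _ => 1) (ψ := fun _ => 0) (by simp) (by simp)
  have h2 := polySum_sub_mul_le hq (φ := fun _ => -1) (ψ := fun _ => 0) (by simp) (by simp)
  simp only [mul_neg, mul_one, polySum_neg_left, polySum_const_bernoulli, mul_zero] at h1 h2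
  linarith

theorem polySum_natCast_bernoulli (hq : ∀ i, 0 ≤ q i ∧ q i ≤ 1) :
    polySum (fun k => (k : ℝ)) (∏ i, (C (1 - q i) + C (q i) * X)) = ∑ i, q i := by
  have h := polySum_sub_mean hq
  rw [polySum_sub_left, polySum_const_bernoulli] at h
  linarith

theorem polySum_sub_mean_sq (hq : ∀ i, 0 ≤ q i ∧ q i ≤ 1) :
    polySum (fun k => ((k : ℝ) - ∑ i, q i) ^ 2) (∏ i, (C (1 - q i) + C (q i) * X)) =
      ∑ i, q i * (1 - q i) := by
  have h1 := polySum_sub_mul_le hq (φ := fun k => (k : ℝ) - ∑ i, q i) (ψ := fun _ => 1)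
    (fun k => by simp) (fun k => by simp)
  have h2 := polySum_sub_mul_le hq (φ := fun k => -((k : ℝ) - ∑ i, q i)) (ψ := fun _ => -1)
    (fun k => by push_cast; linarith) (fun k => by push_cast; linarith)
  simp only [mul_neg, polySum_neg_left, polySum_const_bernoulli, mul_one, ← pow_two] at h1 h2
  linarith

/-- Stein bound for an arbitrary test function: if the increments of `φ` are controlled by
`w φ`, up to the error `δ (6 + 2 |w|)` and an extra term `T`, then `0 ≤ 8 δ + E T`. -/
theorem nonneg_of_increment_le (hq : ∀ i, 0 ≤ q i ∧ q i ≤ 1) {s : ℝ} (hs : 0 < s)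
    (hv : ∑ i, q i * (1 - q i) = s ^ 2) {w φ T : ℕ → ℝ}
    (hw : ∀ k : ℕ, w k = (k - ∑ i, q i) / s)
    (h0 : ∀ k, φ (k + 1) - φ k ≤ 1 / s * (w k * φ k + 1 / s * (6 + 2 * |w k|) + T k))
    (h1 : ∀ k, φ (k + 1) - φ k ≤
      1 / s * (w (k + 1) * φ (k + 1) + 1 / s * (6 + 2 * |w (k + 1)|) + T (k + 1))) :
    0 ≤ 8 * (1 / s) + polySum T (∏ i, (C (1 - q i) + C (q i) * X)) := by
  have h := polySum_sub_mul_le hq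
    (ψ := fun k => 1 / s * (w k * φ k + 1 / s * (6 + 2 * |w k|) + T k)) h0 h1
  set P : ℝ[X] := ∏ i, (C (1 - q i) + C (q i) * X) with hP
  have hPc : ∀ k, 0 ≤ P.coeff k :=
    coeff_prod_nonneg _ _ fun j _ => coeff_bernoulli_nonneg (hq j).1 (hq j).2
  have e1 : polySum (fun k => ((k : ℝ) - ∑ i, q i) * φ k) P =
      s * polySum (fun k => w k * φ k) P := by
    rw [← polySum_mul_left]
    congr 2
    funext k
    rw [hw]
    field_simp
  have e2 : polySum (fun k => 1 / s * (w k * φ k + 1 / s * (6 + 2 * |w k|) + T k)) P =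
      1 / s * (polySum (fun k => w k * φ k) P + 1 / s * (polySum (fun k => 6 + 2 * |w k|) P) +
        polySum T P) := by
    rw [polySum_mul_left, polySum_add_left (fun k => w k * φ k + 1 / s * (6 + 2 * |w k|)) T,
      polySum_add_left, polySum_mul_left]
  have e3 : polySum (fun k => 6 + 2 * |w k|) P ≤ 8 := by
    have hle : polySum (fun k => 6 + 2 * |w k|) P ≤
        polySum (fun k => 7 + 1 / s ^ 2 * ((k : ℝ) - ∑ i, q i) ^ 2) P := by
      refine polySum_mono (fun k => ?_) hPc
      have : 1 / s ^ 2 * ((k : ℝ) - ∑ i, q i) ^ 2 = |w k| ^ 2 := by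
        rw [sq_abs, hw]
        field_simp
      rw [this]
      nlinarith [sq_nonneg (|w k| - 1)]
    refine hle.trans (le_of_eq ?_)
    rw [polySum_add_left, polySum_mul_left, polySum_sub_mean_sq hq, polySum_const_bernoulli, hv,
      one_div_mul_cancel (by positivity)]
    norm_num
  rw [e1, e2, hv, show s ^ 2 * (1 / s * (polySum (fun k => w k * φ k) P +
    1 / s * (polySum (fun k => 6 + 2 * |w k|) P) + polySum T P)) =
      s * (polySum (fun k => w k * φ k) P +
    1 / s * (polySum (fun k => 6 + 2 * |w k|) P) + polySum T P) by field_simp] at h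
  have h' := le_of_mul_le_mul_left h hs
  have := mul_le_mul_of_nonneg_left e3 (one_div_pos.2 hs).le
  linarith

/-- The Berry–Esseen bound for sums of independent Bernoulli variables. -/
theorem abs_polySum_sub_gaussTail_le (hq : ∀ i, 0 ≤ q i ∧ q i ≤ 1) {s : ℝ} (hs : 0 < s)
    (hv : ∑ i, q i * (1 - q i) = s ^ 2) (t : ℝ) :
    |polySum (fun k => if t ≤ (k - ∑ i, q i) / s then 1 else 0)
      (∏ i, (C (1 - q i) + C (q i) * X)) - gaussTail t| ≤ 9 / s := by
  set w : ℕ → ℝ := fun k => (k - ∑ i, q i) / s with hw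
  set δ := 1 / s with hδ
  have hδ0 : 0 < δ := one_div_pos.2 hs
  have hw1 : ∀ k, w (k + 1) = w k + δ := fun k => by
    simp only [hw, hδ]
    push_cast
    ring
  have hlip : ∀ t x y, |x - y| ≤ δ →
      |x * steinSol t x - y * steinSol t y| ≤ δ * (6 + 2 * |y|) := fun t x y h => by
    refine (abs_mul_steinSol_sub_le t x y).trans ?_
    rw [mul_comm]
    exact mul_le_mul_of_nonneg_right h (by positivity)
  have hcell : ∀ k, ∀ x ∈ Set.Icc (w k) (w k + δ), |x - w k| ≤ δ ∧ |x - (w k + δ)| ≤ δ :=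
    fun k x hx => by
      constructor <;> rw [abs_le] <;> constructor <;> linarith [hx.1, hx.2]
  have hind : ∀ {a b : ℝ} (t : ℝ), a ≤ b →
      (if t ≤ a then (1 : ℝ) else 0) ≤ if t ≤ b then 1 else 0 := fun t hab => by
    split_ifs with h h' <;> first | exact absurd (h.trans hab) h' | norm_num
  have lower : ∀ t, 0 ≤ 8 * δ + polySum (fun k => (if t ≤ w k + δ then 1 else 0) - gaussTail t)
      (∏ i, (C (1 - q i) + C (q i) * X)) := by
    intro t
    refine nonneg_of_increment_le hq hs hv (w := w) (φ := fun k => steinSol t (w k))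
      (fun k => rfl) (fun k => ?_) (fun k => ?_)
    · have h := steinSol_sub_le (t := t) (a := w k) (b := w k + δ)
        (m := w k * steinSol t (w k) + δ * (6 + 2 * |w k|)) (by linarith) fun x hx => by
          linarith [(abs_le.1 (hlip t _ _ (hcell k x hx).1)).2]
      rw [hw1]
      rw [add_sub_cancel_left] at h
      linarith
    · have h := steinSol_sub_le (t := t) (a := w k) (b := w k + δ)
        (m := (w k + δ) * steinSol t (w k + δ) + δ * (6 + 2 * |w k + δ|)) (by linarith)
        fun x hx => by linarith [(abs_le.1 (hlip t _ _ (hcell k x hx).2)).2]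
      have h2 := mul_le_mul_of_nonneg_left
        (hind t (show w k + δ ≤ w k + δ + δ by linarith)) hδ0.le
      rw [hw1]
      rw [add_sub_cancel_left] at h
      linarith
  have upper : ∀ t, 0 ≤ 8 * δ + polySum (fun k => gaussTail t - (if t ≤ w k - δ then 1 else 0))
      (∏ i, (C (1 - q i) + C (q i) * X)) := by
    intro t
    refine nonneg_of_increment_le hq hs hv (w := w) (φ := fun k => -steinSol t (w k))
      (fun k => rfl) (fun k => ?_) (fun k => ?_)
    · have h := le_steinSol_sub (t := t) (a := w k) (b := w k + δ)
        (m := w k * steinSol t (w k) - δ * (6 + 2 * |w k|)) (by linarith) fun x hx => by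
          linarith [(abs_le.1 (hlip t _ _ (hcell k x hx).1)).1]
      have h2 := mul_le_mul_of_nonneg_left
        (hind t (show w k - δ ≤ w k by linarith)) hδ0.le
      rw [hw1]
      rw [add_sub_cancel_left] at h
      linarith
    · have h := le_steinSol_sub (t := t) (a := w k) (b := w k + δ)
        (m := (w k + δ) * steinSol t (w k + δ) - δ * (6 + 2 * |w k + δ|)) (by linarith)
        fun x hx => by linarith [(abs_le.1 (hlip t _ _ (hcell k x hx).2)).1]
      rw [hw1, add_sub_cancel_right]
      rw [add_sub_cancel_left] at h
      linarith
  have l := lower (t + δ)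
  have u := upper (t - δ)
  simp only [add_le_add_iff_right, sub_le_sub_iff_right] at l u
  rw [polySum_sub_left, polySum_const_bernoulli] at l u
  have n1 := gaussTail_sub_le (show t ≤ t + δ by linarith)
  have n2 := gaussTail_sub_le (show t - δ ≤ t by linarith)
  have e : 9 / s = 9 * δ := by rw [hδ]; ring
  rw [e, abs_le]
  constructor <;> linarith

end BernoulliSum

section VertexNumber
open Polynomial

theorem polySum_genPoly (φ : ℕ → ℝ) {n : ℕ} (hn : n ≠ 0) :
    polySum φ (genPoly n) = ∑ k ∈ Finset.Icc 1 n, φ k * p n k := by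
  rw [genPoly, map_sum, range_eq_Ico, sum_eq_sum_Ico_succ_bot (by omega)]
  simp only [polySum_monomial]
  rw [p_zero_right, if_neg hn, mul_zero, zero_add]
  exact sum_congr (by ext; simp) fun _ _ => rfl

theorem polySum_natCast (G : ℝ[X]) : polySum (fun k => (k : ℝ)) G = (derivative G).eval 1 := by
  simpa [polySum_one] using polySum_natCast_mul (fun _ => 1) G

theorem polySum_natCast_sq (G : ℝ[X]) :
    polySum (fun k => (k : ℝ) ^ 2) G =
      (derivative (derivative G)).eval 1 + (derivative G).eval 1 := by
  have h := polySum_natCast_mul (fun k => (k : ℝ)) G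
  simp only [← pow_two] at h
  rw [h, polySum_natCast, derivative_mul, derivative_X]
  simp
  ring

theorem mean_eq {n : ℕ} (hn : n ≠ 0) : μ n = (derivative (genPoly n)).eval 1 := by
  rw [← polySum_natCast, polySum_genPoly _ hn, μ]

theorem sigmaSq_eq_polySum {n : ℕ} (hn : n ≠ 0) :
    σsq n = polySum (fun k => ((k : ℝ) - μ n) ^ 2) (genPoly n) := by
  rw [polySum_genPoly _ hn, σsq]

theorem sigmaSq_eq {n : ℕ} (hn : n ≠ 0) :
    σsq n = (derivative (derivative (genPoly n))).eval 1 + μ n - μ n ^ 2 := by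
  have e : ∀ k : ℕ, ((k : ℝ) - μ n) ^ 2 = (k : ℝ) ^ 2 + (-(2 * μ n) * k + μ n ^ 2 * 1) := by
    intro k
    ring
  rw [sigmaSq_eq_polySum hn]
  simp only [e]
  rw [polySum_add_left, polySum_add_left, polySum_mul_left, polySum_mul_left, polySum_one,
    polySum_natCast_sq, polySum_natCast, eval_one_genPoly, mean_eq hn]
  ring

theorem sigmaSq_nonneg (n : ℕ) : 0 ≤ σsq n :=
  sum_nonneg fun _ _ => mul_nonneg (sq_nonneg _) (p_nonneg _ _)

theorem sigmaSq_add_two_sub (n : ℕ) :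
    4 / 27 / ((n : ℝ) + 2) ≤ σsq (n + 2) - σsq (n + 1) := by
  have h1 := derivative_genPoly_sub n
  have h2 := derivative_two_genPoly_sub n
  rw [sigmaSq_eq (by omega), sigmaSq_eq (by omega)]
  rw [← mean_eq (by omega), ← mean_eq (by omega)] at h1
  rw [← mean_eq (by omega)] at h2
  have e1 := sub_eq_iff_eq_add.1 h1
  have e2 := sub_eq_iff_eq_add.1 h2
  rw [e1, e2]
  rw [← sub_nonneg]
  have : 0 ≤ (14 * (n : ℝ) ^ 2 + 58 * n + 48 - 4 * n * (2 * n + 7)) /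
      (27 * ((n : ℝ) + 2) ^ 2 * (n + 3)) := by
    apply div_nonneg _ (by positivity)
    nlinarith [Nat.cast_nonneg (α := ℝ) n, sq_nonneg (n : ℝ)]
  refine this.trans (le_of_eq ?_)
  field_simp
  ring

theorem log_le_sigmaSq (n : ℕ) :
    4 / 27 * (Real.log ((n : ℝ) + 2) - Real.log 2) ≤ σsq (n + 1) := by
  induction n with
  | zero => simpa using sigmaSq_nonneg 1
  | succ n ih =>
    have h := sigmaSq_add_two_sub n
    have hlog : Real.log ((n : ℝ) + 3) ≤ Real.log ((n : ℝ) + 2) + 1 / ((n : ℝ) + 2) := by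
      have h1 := Real.log_le_sub_one_of_pos (x := ((n : ℝ) + 3) / (n + 2)) (by positivity)
      rw [Real.log_div (by positivity) (by positivity)] at h1
      have : ((n : ℝ) + 3) / (n + 2) - 1 = 1 / (n + 2) := by
        field_simp
        ring
      linarith
    push_cast
    rw [show (n : ℝ) + 1 + 2 = n + 3 by ring]
    have e : 4 / 27 / ((n : ℝ) + 2) = 4 / 27 * (1 / ((n : ℝ) + 2)) := by ring
    rw [e] at h
    linarith

theorem tailProb_eq_polySum {n : ℕ} (hn : n ≠ 0) (t : ℝ) :
    tailProb n t =
      polySum (fun k => if μ n + t * Real.sqrt (σsq n) ≤ k then 1 else 0) (genPoly n) := by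
  rw [polySum_genPoly _ hn, tailProb, sum_filter]
  simp

theorem tailProb_nonneg (n : ℕ) (t : ℝ) : 0 ≤ tailProb n t :=
  sum_nonneg fun _ _ => p_nonneg _ _

theorem tailProb_le_one {n : ℕ} (hn : n ≠ 0) (t : ℝ) : tailProb n t ≤ 1 := by
  rw [tailProb_eq_polySum hn]
  refine (polySum_mono (ψ := fun _ => 1) (fun k => by split_ifs <;> norm_num) fun k => ?_).trans
    (by rw [polySum_one, eval_one_genPoly])
  rw [coeff_genPoly]
  exact p_nonneg n k

theorem abs_tailProb_sub_gaussTail_le {n : ℕ} (hn : n ≠ 0) (hσ : 0 < σsq n) (t : ℝ) :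
    |tailProb n t - gaussTail t| ≤ 9 / Real.sqrt (σsq n) := by
  obtain ⟨m, q, hq, hP⟩ := exists_eq_prod_bernoulli (splits_genPoly n) (eval_one_genPoly n)
    fun x hx => (eval_genPoly_pos n hx).ne'
  have hmean : μ n = ∑ i, q i := by
    rw [mean_eq hn, ← polySum_natCast, hP, polySum_natCast_bernoulli hq]
  have hvar : ∑ i, q i * (1 - q i) = Real.sqrt (σsq n) ^ 2 := by
    rw [Real.sq_sqrt hσ.le, sigmaSq_eq_polySum hn, hP, hmean, polySum_sub_mean_sq hq]
  have hs := Real.sqrt_pos.2 hσ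
  have h := abs_polySum_sub_gaussTail_le hq hs hvar t
  rw [← hP, ← hmean] at h
  rw [tailProb_eq_polySum hn]
  have e : ∀ k : ℕ, μ n + t * Real.sqrt (σsq n) ≤ k ↔ t ≤ (k - μ n) / Real.sqrt (σsq n) :=
    fun k => by rw [le_div_iff₀ hs, le_sub_iff_add_le, add_comm]
  simp only [e]
  exact h

end VertexNumber

open MeasureTheory in
/-- Berry–Esseen bound: there is an absolute constant `c ∈ (0, ∞)` such that for every
`n ≥ 2` and every real `t`,
`|P((f_0(T_n) − μ_n)/σ_n ≥ t) − ∫_t^∞ e^{−u²/2}/√(2π) du| ≤ c/√(log n)`. -/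
theorem berry_esseen :
    ∃ c : ℝ, 0 < c ∧ ∀ n : ℕ, 2 ≤ n → ∀ t : ℝ,
      |tailProb n t - ∫ u in Set.Ioi t, Real.exp (-u ^ 2 / 2) / Real.sqrt (2 * Real.pi)| ≤
        c / Real.sqrt (Real.log n) := by
  refine ⟨36, by norm_num, fun n hn t => ?_⟩
  change |tailProb n t - gaussTail t| ≤ _
  have hn0 : n ≠ 0 := by omega
  have hlog : 0 < Real.log n := Real.log_pos (by exact_mod_cast hn)
  have hsl : 0 < Real.sqrt (Real.log n) := Real.sqrt_pos.2 hlog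
  rw [le_div_iff₀ hsl]
  rcases le_total (Real.log n) 2 with h2 | h2
  · have h1 : |tailProb n t - gaussTail t| ≤ 1 := by
      rw [abs_le]
      constructor <;> linarith [tailProb_nonneg n t, tailProb_le_one hn0 t, gaussTail_nonneg t,
        gaussTail_le_one t]
    have h3 : Real.sqrt (Real.log n) ≤ 36 := by
      rw [Real.sqrt_le_left (by norm_num)]
      linarith
    nlinarith
  · have hvar : Real.log n ≤ 4 ^ 2 * σsq n := by
      have h := log_le_sigmaSq (n - 1)
      rw [Nat.sub_add_cancel (by omega), Nat.cast_sub (by omega), Nat.cast_one] at h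
      have h3 : Real.log n ≤ Real.log ((n : ℝ) - 1 + 2) :=
        Real.log_le_log (by positivity) (by linarith)
      have h4 := Real.log_two_lt_d9
      linarith
    have hσ : 0 < σsq n := by linarith
    have hs := Real.sqrt_pos.2 hσ
    have h1 := abs_tailProb_sub_gaussTail_le hn0 hσ t
    rw [le_div_iff₀ hs] at h1
    have h3 : Real.sqrt (Real.log n) ≤ 4 * Real.sqrt (σsq n) := by
      refine (Real.sqrt_le_sqrt hvar).trans (le_of_eq ?_)
      rw [Real.sqrt_mul (by norm_num), Real.sqrt_sq (by norm_num)]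
    nlinarith [mul_le_mul_of_nonneg_left h3 (abs_nonneg (tailProb n t - gaussTail t))]
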